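/- arXiv:1903.05822 — 8 statements merged into one kernel-verified Lean document; each statement's English description precedes it below -/
import Mathlib

section
/- For every integer r ≥ 1, the kernel of the ℂ-algebra homomorphism φ : ℂ[X₁,X₂,Y₁,Y₂,W] → ℂ[u₁,u₂,v₁,v₂] defined by X₁ ↦ (u₁v₁−u₂v₂)^(r−1)(u₁−(−1)^r u₂), Y₁ ↦ (u₁v₁−u₂v₂)^(r−1)(v₁−(−1)^r v₂), X₂ ↦ (−1)^r u₁u₂, Y₂ ↦ (−1)^r v₁v₂, W ↦ u₁v₁+u₂v₂ is the principal ideal generated by (W²−4X₂Y₂)^r − (X₁²Y₂ + X₂Y₁² + W·X₁Y₁). -/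
open MvPolynomial

/-- The map sending `X₁, X₂, Y₁, Y₂, W` (the variables of `ℂ[X₁,X₂,Y₁,Y₂,W]`, indexed
`0, 1, 2, 3, 4`) to the five generators of the Coulomb branch ring inside
`ℂ[u₁,u₂,v₁,v₂]` (variables indexed `u₁ = 0, u₂ = 1, v₁ = 2, v₂ = 3`). -/
noncomputable def coulombGenerators (r : ℕ) : Fin 5 → MvPolynomial (Fin 4) ℂ :=
  ![(X 0 * X 2 - X 1 * X 3) ^ (r - 1) * (X 0 - (-1) ^ r * X 1),
    (-1) ^ r * X 0 * X 1,
    (X 0 * X 2 - X 1 * X 3) ^ (r - 1) * (X 2 - (-1) ^ r * X 3),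
    (-1) ^ r * X 2 * X 3,
    X 0 * X 2 + X 1 * X 3]

/-- The defining relation. -/
noncomputable def coulombRel (r : ℕ) : MvPolynomial (Fin 5) ℂ :=
  ((X 4) ^ 2 - 4 * X 1 * X 3) ^ r
        - ((X 0) ^ 2 * X 3 + X 1 * (X 2) ^ 2 + X 4 * X 0 * X 2)

theorem coulomb_pseudo (r : ℕ) (p : MvPolynomial (Fin 5) ℂ) :
    ∃ (k : ℕ) (q : MvPolynomial (Fin 5) ℂ) (a b : MvPolynomial (Fin 4) ℂ),
      X 3 ^ k * p = q * coulombRel r + rename Fin.succ a + X 0 * rename Fin.succ b := by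
  induction p using MvPolynomial.induction_on with
  | C c => exact ⟨0, 0, C c, 0, by simp⟩
  | add p p' h h' =>
    obtain ⟨k, q, a, b, h⟩ := h
    obtain ⟨k', q', a', b', h'⟩ := h'
    refine ⟨k + k', X 3 ^ k' * q + X 3 ^ k * q', X 2 ^ k' * a + X 2 ^ k * a',
      X 2 ^ k' * b + X 2 ^ k * b', ?_⟩
    have e : (Fin.succ (2 : Fin 4)) = (3 : Fin 5) := rfl
    simp only [map_add, map_mul, map_pow, rename_X, e]
    linear_combination X 3 ^ k' * h + X 3 ^ k * h'
  | mul_X p i h =>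
    obtain ⟨k, q, a, b, h⟩ := h
    induction i using Fin.cases with
    | zero =>
      refine ⟨k + 1, X 3 * X 0 * q - rename Fin.succ b,
        b * ((X 3 ^ 2 - 4 * X 0 * X 2) ^ r - X 0 * X 1 ^ 2), X 2 * a - b * X 3 * X 1, ?_⟩
      have e0 : (Fin.succ (0 : Fin 4)) = (1 : Fin 5) := rfl
      have e1 : (Fin.succ (1 : Fin 4)) = (2 : Fin 5) := rfl
      have e2 : (Fin.succ (2 : Fin 4)) = (3 : Fin 5) := rfl
      have e3 : (Fin.succ (3 : Fin 4)) = (4 : Fin 5) := rfl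
      have e4 : rename Fin.succ (4 : MvPolynomial (Fin 4) ℂ) = (4 : MvPolynomial (Fin 5) ℂ) :=
        map_ofNat _ 4
      simp only [map_sub, map_mul, map_pow, rename_X, e0, e1, e2, e3, e4]
      rw [coulombRel] at *
      linear_combination X 3 * X 0 * h
    | succ j =>
      refine ⟨k, q * X j.succ, a * X j, b * X j, ?_⟩
      simp only [map_mul, rename_X]
      linear_combination X j.succ * h

theorem coulomb_point (r : ℕ) (hr : 1 ≤ r) (x2 y1 y2 δ w v c : ℂ) (hy : y2 ≠ 0)
    (hδ : δ ≠ 0) (hD : δ ^ 2 = w ^ 2 - 4 * x2 * y2) (hc : c * δ ^ (r - 1) = y1)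
    (hv : v ^ 2 = c * v + y2) :
    ∃ t : Fin 4 → ℂ, ∀ i, eval t (coulombGenerators r i) =
      (Fin.cons (δ ^ (r - 1) / (2 * y2) * (2 * δ * v - (w + δ) * c)) ![x2, y1, y2, w] :
        Fin 5 → ℂ) i := by
  have hv0 : v ≠ 0 := by
    rintro rfl
    apply hy
    linear_combination -hv
  have hs : ((-1 : ℂ) ^ r) * (-1) ^ r = 1 := by
    rw [← mul_pow]; simp
  generalize hS : ((-1 : ℂ) ^ r) = s at hs
  have hs0 : s ≠ 0 := by
    rintro rfl
    simp at hs
  have hc' : v - y2 / v = c := by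
    field_simp
    linear_combination hv
  have hd : (w + δ) / (2 * v) * v - (w - δ) * v * s / (2 * y2) * (s * y2 / v) = δ := by
    field_simp
    linear_combination (δ - w) * hs
  refine ⟨![(w + δ) / (2 * v), (w - δ) * v * s / (2 * y2), v, s * y2 / v], ?_⟩
  intro i
  fin_cases i
  · simp [coulombGenerators, hS]
    rw [hd, ← hc']
    field_simp
    linear_combination (- w * v ^ 2 + δ * v ^ 2) * hs
  · simp [coulombGenerators, hS]
    field_simp
    linear_combination (w ^ 2 - δ ^ 2) * hs - hD
  · simp [coulombGenerators, hS]
    rw [hd, ← hc, ← hc']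
    field_simp
    linear_combination (-y2) * hs
  · simp [coulombGenerators, hS]
    field_simp
    linear_combination hs
  · simp [coulombGenerators, hS]
    field_simp
    linear_combination (w - δ) * hs

theorem coulomb_eval_ker (r : ℕ) (g : MvPolynomial (Fin 5) ℂ)
    (hg : aeval (R := ℂ) (coulombGenerators r) g = 0) (t : Fin 4 → ℂ) (x : Fin 5 → ℂ)
    (h : ∀ i, eval t (coulombGenerators r i) = x i) : eval x g = 0 := by
  have h1 : eval t (aeval (R := ℂ) (coulombGenerators r) g) = eval x g := by
    have h2 : x = fun i => eval t (coulombGenerators r i) := by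
      funext i; rw [h]
    rw [h2]
    clear hg
    induction g using MvPolynomial.induction_on with
    | C c => simp
    | add p q hp hq => rw [map_add, map_add, map_add, hp, hq]
    | mul_X p i hp => rw [map_mul, map_mul, map_mul, hp, aeval_X, eval_X]
  rw [← h1, hg, map_zero]

theorem coulomb_indep (r : ℕ) (hr : 1 ≤ r) (a b : MvPolynomial (Fin 4) ℂ)
    (h : aeval (R := ℂ) (coulombGenerators r)
      (rename Fin.succ a + X 0 * rename Fin.succ b) = 0) : a = 0 ∧ b = 0 := by
  let M : MvPolynomial (Fin 4) ℂ := X 2 * (X 3 ^ 2 - 4 * X 0 * X 2) *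
    (X 1 ^ 2 + 4 * X 2 * (X 3 ^ 2 - 4 * X 0 * X 2) ^ (r - 1))
  have hM : M ≠ 0 := by
    intro h0
    have := congrArg (eval (![0, 0, 1, 1] : Fin 4 → ℂ)) h0
    simp [M] at this
  have key : ∀ y : Fin 4 → ℂ, eval y M ≠ 0 → eval y a = 0 ∧ eval y b = 0 := by
    intro y hy
    have hyy : y = ![y 0, y 1, y 2, y 3] := by
      funext i; fin_cases i <;> rfl
    generalize y 0 = x2 at hyy
    generalize y 1 = y1 at hyy
    generalize y 2 = y2 at hyy
    generalize y 3 = w at hyy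
    obtain ⟨δ, hδ⟩ := IsAlgClosed.exists_pow_nat_eq (w ^ 2 - 4 * x2 * y2) (n := 2) (by norm_num)
    have hy' : y2 * (w ^ 2 - 4 * x2 * y2) *
        (y1 ^ 2 + 4 * y2 * (w ^ 2 - 4 * x2 * y2) ^ (r - 1)) ≠ 0 := by
      simpa [M, hyy] using hy
    rw [← hδ] at hy'
    have h1 : y2 ≠ 0 := by
      rintro rfl; simp at hy'
    have h2 : δ ≠ 0 := by
      rintro rfl; simp at hy'
    have h3 := right_ne_zero_of_mul hy'
    have h4 : δ ^ (r - 1) ≠ 0 := pow_ne_zero _ h2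
    obtain ⟨c, hc⟩ : ∃ c, c * δ ^ (r - 1) = y1 := ⟨y1 / δ ^ (r - 1), by field_simp⟩
    obtain ⟨ρ, hρ⟩ := IsAlgClosed.exists_pow_nat_eq (c ^ 2 + 4 * y2) (n := 2) (by norm_num)
    have h5 : ρ ≠ 0 := by
      rintro rfl
      apply h3
      rw [← hc, ← pow_mul, mul_comm 2 (r - 1), pow_mul]
      linear_combination -(δ ^ (r - 1)) ^ 2 * hρ
    obtain ⟨t, ht⟩ := coulomb_point r hr x2 y1 y2 δ w ((c + ρ) / 2) c h1 h2 hδ hc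
      (by linear_combination hρ / 4)
    obtain ⟨t', ht'⟩ := coulomb_point r hr x2 y1 y2 δ w ((c - ρ) / 2) c h1 h2 hδ hc
      (by linear_combination hρ / 4)
    have E := coulomb_eval_ker r _ h t _ ht
    have E' := coulomb_eval_ker r _ h t' _ ht'
    have hcomp : ∀ z : ℂ, (Fin.cons z y : Fin 5 → ℂ) ∘ Fin.succ = y := fun z => by
      funext i; simp
    simp only [map_add, map_mul, eval_rename, ← hyy, hcomp, eval_X, Fin.cons_zero] at E E'
    have hb : δ ^ (r - 1) / (2 * y2) * (2 * δ * ρ) * eval y b = 0 := by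
      linear_combination E - E'
    have hb' : eval y b = 0 := by
      rcases mul_eq_zero.mp hb with h6 | h6
      · exfalso
        simp [h1, h2, h5] at h6
      · exact h6
    refine ⟨?_, hb'⟩
    rw [hb'] at E
    simpa using E
  constructor
  · have : a * M = 0 := by
      apply MvPolynomial.funext
      intro y
      by_cases hy : eval y M = 0
      · simp [hy]
      · simp [(key y hy).1]
    exact (mul_eq_zero.mp this).resolve_right hM
  · have : b * M = 0 := by
      apply MvPolynomial.funext
      intro y
      by_cases hy : eval y M = 0
      · simp [hy]
      · simp [(key y hy).2]
    exact (mul_eq_zero.mp this).resolve_right hM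

theorem coulomb_rel_mem (r : ℕ) (hr : 1 ≤ r) :
    aeval (R := ℂ) (coulombGenerators r) (coulombRel r) = 0 := by
  obtain ⟨n, rfl⟩ : ∃ n, r = n + 1 := ⟨r - 1, by omega⟩
  have hs : ((-1 : MvPolynomial (Fin 4) ℂ) ^ (n + 1)) * (-1) ^ (n + 1) = 1 := by
    rw [← mul_pow]; simp
  have e4 : aeval (R := ℂ) (coulombGenerators (n + 1)) (4 : MvPolynomial (Fin 5) ℂ) = 4 :=
    map_ofNat _ 4
  simp only [coulombRel, map_sub, map_add, map_mul, map_pow, aeval_X, e4]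
  have g0 : coulombGenerators (n + 1) 0 = (X 0 * X 2 - X 1 * X 3) ^ n *
    (X 0 - (-1) ^ (n + 1) * X 1) := rfl
  have g1 : coulombGenerators (n + 1) 1 = (-1) ^ (n + 1) * X 0 * X 1 := rfl
  have g2 : coulombGenerators (n + 1) 2 = (X 0 * X 2 - X 1 * X 3) ^ n *
    (X 2 - (-1) ^ (n + 1) * X 3) := rfl
  have g3 : coulombGenerators (n + 1) 3 = (-1) ^ (n + 1) * X 2 * X 3 := rfl
  have g4 : coulombGenerators (n + 1) 4 = X 0 * X 2 + X 1 * X 3 := rfl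
  rw [g0, g1, g2, g3, g4]
  generalize ((-1 : MvPolynomial (Fin 4) ℂ) ^ (n + 1)) = s at hs
  have hD : ((X 0 * X 2 + X 1 * X 3) ^ 2 - 4 * (s * X 0 * X 1) * (s * X 2 * X 3) :
      MvPolynomial (Fin 4) ℂ) = (X 0 * X 2 - X 1 * X 3) ^ 2 := by
    linear_combination (-4 * X 0 * X 1 * X 2 * X 3) * hs
  have hE : ((X 0 - s * X 1) ^ 2 * (s * X 2 * X 3) + (s * X 0 * X 1) * (X 2 - s * X 3) ^ 2
      + (X 0 * X 2 + X 1 * X 3) * (X 0 - s * X 1) * (X 2 - s * X 3) :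
      MvPolynomial (Fin 4) ℂ) = (X 0 * X 2 - X 1 * X 3) ^ 2 := by
    linear_combination (-4 * X 0 * X 1 * X 2 * X 3 + s * X 1 ^ 2 * X 2 * X 3
      + s * X 0 * X 1 * X 3 ^ 2 + X 0 * X 1 * X 2 * X 3 + X 1 ^ 2 * X 3 ^ 2) * hs
  rw [hD]
  rw [← pow_mul, mul_comm 2 (n + 1), pow_mul, pow_succ]
  linear_combination (-((X 0 * X 2 - X 1 * X 3) ^ n) ^ 2) * hE

/-- The kernel of the `ℂ`-algebra map `ℂ[X₁,X₂,Y₁,Y₂,W] → ℂ[u₁,u₂,v₁,v₂]`,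
`X₁ ↦ (u₁v₁−u₂v₂)^(r−1)(u₁−(−1)^r u₂)`, `X₂ ↦ (−1)^r u₁u₂`,
`Y₁ ↦ (u₁v₁−u₂v₂)^(r−1)(v₁−(−1)^r v₂)`, `Y₂ ↦ (−1)^r v₁v₂`, `W ↦ u₁v₁+u₂v₂`,
is the principal ideal generated by `(W²−4X₂Y₂)^r − (X₁²Y₂ + X₂Y₁² + W·X₁Y₁)`. -/
theorem ker_coulomb_presentation (r : ℕ) (hr : 1 ≤ r) :
    RingHom.ker (MvPolynomial.aeval (R := ℂ) (coulombGenerators r)) =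
      Ideal.span {((X 4) ^ 2 - 4 * X 1 * X 3) ^ r
        - ((X 0) ^ 2 * X 3 + X 1 * (X 2) ^ 2 + X 4 * X 0 * X 2)} := by
  change _ = Ideal.span {coulombRel r}
  apply le_antisymm
  · intro p hp
    rw [RingHom.mem_ker] at hp
    obtain ⟨k, q, a, b, h⟩ := coulomb_pseudo r p
    have h0 : aeval (R := ℂ) (coulombGenerators r)
        (rename Fin.succ a + X 0 * rename Fin.succ b) = 0 := by
      have h1 : rename Fin.succ a + X 0 * rename Fin.succ b
          = X 3 ^ k * p - q * coulombRel r := by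
        linear_combination -h
      rw [h1, map_sub, map_mul, map_mul, hp, coulomb_rel_mem r hr]
      simp
    obtain ⟨rfl, rfl⟩ := coulomb_indep r hr a b h0
    have h2 : X 3 ^ k * p = q * coulombRel r := by simpa using h
    have hnd : ¬ (X 3 : MvPolynomial (Fin 5) ℂ) ∣ coulombRel r := by
      rintro ⟨z, hz⟩
      have := congrArg (eval (![0, 0, 0, 0, 1] : Fin 5 → ℂ)) hz
      simp [coulombRel] at this
    have hprime : Prime (X 3 : MvPolynomial (Fin 5) ℂ) := MvPolynomial.X_prime
    obtain ⟨z, rfl⟩ := hprime.pow_dvd_of_dvd_mul_right k hnd ⟨p, h2.symm⟩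
    rw [Ideal.mem_span_singleton]
    refine ⟨z, ?_⟩
    apply mul_left_cancel₀ (pow_ne_zero k hprime.ne_zero)
    linear_combination h2
  · rw [Ideal.span_singleton_le_iff_mem, RingHom.mem_ker]
    exact coulomb_rel_mem r hr
end

section
/- For every integer r ≥ 1, the following identity of rational functions in the variable t over ℚ holds: 1/((1−t²)²(1−t⁴)) + t²/((1−t²)²(1−t⁴)) + 2t^(2r−1)/((1−t²)³(1−t^(2r−1))) + t^(4r−2)/((1−t²)²(1−t^(2r−1))²) = (1−t^(4r))/((1−t²)³(1−t^(2r−1))²). -/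
open RatFunc

theorem one_sub_X_pow_ne (n : ℕ) (hn : n ≠ 0) : (1 - X ^ n : RatFunc ℚ) ≠ 0 := by
  intro h
  have h1 : (algebraMap (Polynomial ℚ) (RatFunc ℚ)) (1 - Polynomial.X ^ n) = 0 := by
    simpa using h
  have h2 : (1 - Polynomial.X ^ n : Polynomial ℚ) = 0 :=
    (map_eq_zero_iff _ (RatFunc.algebraMap_injective ℚ)).1 h1
  have h3 := congrArg (Polynomial.eval 0) h2
  simp [hn] at h3

/-- The summation identity for the monopole formula of the Coulomb branch `M_C(r,2,1)`:
the four closed-form pieces of the monopole formula sum to the Hilbert series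
`H(t) = (1−t^{4r})/((1−t²)³(1−t^{2r−1})²)`, as rational functions in `t` over `ℚ`. -/
theorem hilbert_series_identity (r : ℕ) (hr : 1 ≤ r) :
    (1 / ((1 - X ^ 2) ^ 2 * (1 - X ^ 4))
        + X ^ 2 / ((1 - X ^ 2) ^ 2 * (1 - X ^ 4))
        + 2 * X ^ (2 * r - 1) / ((1 - X ^ 2) ^ 3 * (1 - X ^ (2 * r - 1)))
        + X ^ (4 * r - 2) / ((1 - X ^ 2) ^ 2 * (1 - X ^ (2 * r - 1)) ^ 2) : RatFunc ℚ) =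
      (1 - X ^ (4 * r)) / ((1 - X ^ 2) ^ 3 * (1 - X ^ (2 * r - 1)) ^ 2) := by
  have h2 := one_sub_X_pow_ne 2 (by norm_num)
  have h4 := one_sub_X_pow_ne 4 (by norm_num)
  have hu := one_sub_X_pow_ne (2 * r - 1) (by omega)
  have e1 : (X : RatFunc ℚ) ^ (4 * r - 2) = (X ^ (2 * r - 1)) ^ 2 := by
    rw [← pow_mul]; congr 1; omega
  have e2 : (X : RatFunc ℚ) ^ (4 * r) = (X ^ (2 * r - 1)) ^ 2 * X ^ 2 := by
    rw [← pow_mul, ← pow_add]; congr 1; omega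
  have e4 : (1 - X ^ 4 : RatFunc ℚ) = (1 - X ^ 2) * (1 + X ^ 2) := by ring
  rw [e4] at h4 ⊢
  have h5 := right_ne_zero_of_mul h4
  rw [e1, e2]
  generalize (X : RatFunc ℚ) ^ (2 * r - 1) = u at *
  generalize (X : RatFunc ℚ) ^ 2 = v at *
  field_simp
  ring
end

section
/- Let r ≥ 1 be an integer and let t be a complex number with |t| < 1. Then the family (n₁,n₂) ↦ t^((2r−2)(n₁−n₂)+|n₁|+|n₂|) indexed by pairs of integers n₁ > n₂ is absolutely summable, the family n ↦ t^(2|n|) indexed by n ∈ ℤ is absolutely summable, and (1−t²)^(−2) · Σ_{n₁>n₂∈ℤ} t^((2r−2)(n₁−n₂)+|n₁|+|n₂|) + (1−t²)^(−1)(1−t⁴)^(−1) · Σ_{n∈ℤ} t^(2|n|) = (1−t^(4r))/((1−t²)³(1−t^(2r−1))²). -/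
def monoF : (ℕ × ℕ) ⊕ ((ℕ × ℕ) ⊕ (ℕ × ℕ)) → {p : ℤ × ℤ // p.2 < p.1}
  | Sum.inl (k, m) => ⟨((m : ℤ) + k + 1, (m : ℤ)), by simp only; omega⟩
  | Sum.inr (Sum.inl (k, m)) => ⟨(-(m : ℤ), -(m : ℤ) - k - 1), by simp only; omega⟩
  | Sum.inr (Sum.inr (i, j)) => ⟨((i : ℤ) + 1, -(j : ℤ) - 1), by simp only; omega⟩

theorem monoF_bij : Function.Bijective monoF := by
  constructor
  · rintro (⟨a, b⟩ | ⟨a, b⟩ | ⟨a, b⟩) (⟨c, d⟩ | ⟨c, d⟩ | ⟨c, d⟩) h <;>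
      simp only [monoF, Subtype.mk.injEq, Prod.mk.injEq] at h <;>
      first
        | (exfalso; omega)
        | (obtain ⟨rfl, rfl⟩ : a = c ∧ b = d := by omega
           rfl)
  · rintro ⟨⟨x, y⟩, h⟩
    simp only at h
    by_cases hy : 0 ≤ y
    · refine ⟨Sum.inl ((x - y - 1).toNat, y.toNat), ?_⟩
      simp only [monoF, Subtype.mk.injEq, Prod.mk.injEq]
      omega
    · by_cases hx : x ≤ 0
      · refine ⟨Sum.inr (Sum.inl ((x - y - 1).toNat, (-x).toNat)), ?_⟩
        simp only [monoF, Subtype.mk.injEq, Prod.mk.injEq]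
        omega
      · refine ⟨Sum.inr (Sum.inr ((x - 1).toNat, (-y - 1).toNat)), ?_⟩
        simp only [monoF, Subtype.mk.injEq, Prod.mk.injEq]
        omega

theorem mono_prod {u v : ℂ} (hu : ‖u‖ < 1) (hv : ‖v‖ < 1) :
    HasSum (fun p : ℕ × ℕ => u ^ p.1 * v ^ p.2) ((1 - u)⁻¹ * (1 - v)⁻¹) := by
  refine (hasSum_geometric_of_norm_lt_one hu).mul (hasSum_geometric_of_norm_lt_one hv) ?_
  exact summable_mul_of_summable_norm (summable_norm_geometric_of_norm_lt_one hu)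
    (summable_norm_geometric_of_norm_lt_one hv)

theorem mono_sum1 (s : ℕ) (t : ℂ) (ht : ‖t‖ < 1) :
    HasSum (fun p : {p : ℤ × ℤ // p.2 < p.1} =>
      t ^ ((2 * ((s + 1 : ℕ) : ℤ) - 2) * (p.1.1 - p.1.2) + |p.1.1| + |p.1.2|))
      (t ^ (2 * s + 1) * ((1 - t ^ (2 * s + 1))⁻¹ * (1 - t ^ 2)⁻¹) +
        (t ^ (2 * s + 1) * ((1 - t ^ (2 * s + 1))⁻¹ * (1 - t ^ 2)⁻¹) +
        t ^ (2 * (2 * s + 1)) * ((1 - t ^ (2 * s + 1))⁻¹ * (1 - t ^ (2 * s + 1))⁻¹))) := by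
  have hx : ‖t ^ (2 * s + 1)‖ < 1 := by
    rw [norm_pow]; exact pow_lt_one₀ (norm_nonneg _) ht (by omega)
  have h2 : ‖t ^ 2‖ < 1 := by
    rw [norm_pow]; exact pow_lt_one₀ (norm_nonneg _) ht (by omega)
  rw [← (Equiv.ofBijective monoF monoF_bij).hasSum_iff]
  have key : ∀ (e : ℤ) (n : ℕ), e = n → t ^ e = t ^ n := by
    rintro e n rfl; exact zpow_natCast t n
  refine HasSum.sum ?_ (HasSum.sum ?_ ?_)
  · refine ((mono_prod hx h2).mul_left (t ^ (2 * s + 1))).congr_fun ?_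
    rintro ⟨k, m⟩
    simp only [Function.comp, Equiv.ofBijective_apply, monoF]
    rw [key _ ((2 * s + 1) + ((2 * s + 1) * k + 2 * m))]
    · simp only [pow_add, pow_mul]
    · rw [abs_of_nonneg (by omega), abs_of_nonneg (by omega)]; push_cast; ring
  · refine ((mono_prod hx h2).mul_left (t ^ (2 * s + 1))).congr_fun ?_
    rintro ⟨k, m⟩
    simp only [Function.comp, Equiv.ofBijective_apply, monoF]
    rw [key _ ((2 * s + 1) + ((2 * s + 1) * k + 2 * m))]
    · simp only [pow_add, pow_mul]
    · rw [abs_of_nonpos (by omega), abs_of_nonpos (by omega)]; push_cast; ring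
  · refine ((mono_prod hx hx).mul_left (t ^ (2 * (2 * s + 1)))).congr_fun ?_
    rintro ⟨k, m⟩
    simp only [Function.comp, Equiv.ofBijective_apply, monoF]
    rw [key _ (2 * (2 * s + 1) + ((2 * s + 1) * k + (2 * s + 1) * m))]
    · simp only [pow_add, pow_mul]
    · rw [abs_of_nonneg (by omega), abs_of_nonpos (by omega)]; push_cast; ring

theorem mono_sum2 (t : ℂ) (ht : ‖t‖ < 1) :
    HasSum (fun n : ℤ => t ^ (2 * |n|)) ((1 - t ^ 2)⁻¹ + t ^ 2 * (1 - t ^ 2)⁻¹) := by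
  have h2 : ‖t ^ 2‖ < 1 := by
    rw [norm_pow]; exact pow_lt_one₀ (norm_nonneg _) ht (by omega)
  have key : ∀ (e : ℤ) (n : ℕ), e = n → t ^ e = t ^ n := by
    rintro e n rfl; exact zpow_natCast t n
  have hg := hasSum_geometric_of_norm_lt_one h2
  refine HasSum.of_nat_of_neg_add_one ?_ ?_
  · refine hg.congr_fun fun n => ?_
    rw [key _ (2 * n), pow_mul]
    rw [abs_of_nonneg (by omega)]; push_cast; ring
  · refine (hg.mul_left (t ^ 2)).congr_fun fun n => ?_
    rw [key _ (2 + 2 * n), pow_add, pow_mul]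
    rw [abs_of_nonpos (by omega)]; push_cast; ring

/-- The monopole formula for the Hilbert series of the Coulomb branch `M_C(r,2,1)`:
for `|t| < 1`, the family `t^{(2r−2)(n₁−n₂)+|n₁|+|n₂|}` over pairs `n₁ > n₂` of integers
and the family `t^{2|n|}` over `n ∈ ℤ` are absolutely summable, and
`(1−t²)⁻² Σ_{n₁>n₂} t^{(2r−2)(n₁−n₂)+|n₁|+|n₂|} + (1−t²)⁻¹(1−t⁴)⁻¹ Σ_{n∈ℤ} t^{2|n|}
  = (1−t^{4r})/((1−t²)³(1−t^{2r−1})²)`. -/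
theorem monopole_formula_rank_two (r : ℕ) (hr : 1 ≤ r) (t : ℂ) (ht : ‖t‖ < 1) :
    Summable (fun p : {p : ℤ × ℤ // p.2 < p.1} =>
      ‖t ^ ((2 * (r : ℤ) - 2) * (p.1.1 - p.1.2) + |p.1.1| + |p.1.2|)‖) ∧
    Summable (fun n : ℤ => ‖t ^ (2 * |n|)‖) ∧
    ((1 - t ^ 2) ^ 2)⁻¹ *
        (∑' p : {p : ℤ × ℤ // p.2 < p.1},
          t ^ ((2 * (r : ℤ) - 2) * (p.1.1 - p.1.2) + |p.1.1| + |p.1.2|))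
      + (1 - t ^ 2)⁻¹ * (1 - t ^ 4)⁻¹ * (∑' n : ℤ, t ^ (2 * |n|)) =
      (1 - t ^ (4 * r)) / ((1 - t ^ 2) ^ 3 * (1 - t ^ (2 * r - 1)) ^ 2) := by
  obtain ⟨s, rfl⟩ : ∃ s, r = s + 1 := ⟨r - 1, by omega⟩
  have h1 := mono_sum1 s t ht
  have h2 := mono_sum2 t ht
  refine ⟨h1.summable.norm, h2.summable.norm, ?_⟩
  rw [h1.tsum_eq, h2.tsum_eq]
  have hne : ∀ n : ℕ, n ≠ 0 → 1 - t ^ n ≠ 0 := by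
    intro n hn h
    have h' : ‖t ^ n‖ < 1 := by
      rw [norm_pow]; exact pow_lt_one₀ (norm_nonneg _) ht hn
    rw [← sub_eq_zero.mp h] at h'
    simp at h'
  have e1 : t ^ (4 * (s + 1)) = (t ^ (2 * s + 1)) ^ 2 * t ^ 2 := by
    rw [← pow_mul, ← pow_add]; congr 1; ring
  have e2 : 2 * (s + 1) - 1 = 2 * s + 1 := by omega
  have e3 : t ^ (2 * (2 * s + 1)) = (t ^ (2 * s + 1)) ^ 2 := by
    rw [← pow_mul]; congr 1; ring
  rw [e1, e2, e3]
  have a1 := hne (2 * s + 1) (by omega)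
  have a2 := hne 2 (by omega)
  have a4 := hne 4 (by omega)
  have e4 : t ^ 4 = (t ^ 2) ^ 2 := by ring
  rw [e4] at a4 ⊢
  generalize t ^ (2 * s + 1) = x at *
  generalize t ^ 2 = y at *
  have a5 : 1 + y ≠ 0 := by
    intro h; apply a4; linear_combination (1 - y) * h
  have e5 : 1 - y ^ 2 = (1 - y) * (1 + y) := by ring
  rw [e5]
  field_simp
  ring
end

section
/- Fix an integer r ≥ 1. Define a bracket on ℂ[u₁,u₂,v₁,v₂] by {f,g} = (∂f/∂u₁)(∂g/∂v₁) − (∂f/∂v₁)(∂g/∂u₁) + (∂f/∂u₂)(∂g/∂v₂) − (∂f/∂v₂)(∂g/∂u₂), and set x₁ = (u₁v₁−u₂v₂)^(r−1)(u₁−(−1)^r u₂), y₁ = (u₁v₁−u₂v₂)^(r−1)(v₁−(−1)^r v₂), x₂ = (−1)^r u₁u₂, y₂ = (−1)^r v₁v₂, w = u₁v₁+u₂v₂. Then {x₂,y₂} = w, {w,x₂} = −2x₂, {w,y₂} = 2y₂, {y₂,x₁} = y₁, {y₂,y₁} = 0, {x₂,x₁} = 0, {x₂,y₁} = −x₁,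 {w,x₁} = −x₁, and {w,y₁} = y₁. -/
open MvPolynomial

/-- The Poisson bracket `{f,g} = f_{u₁} g_{v₁} − f_{v₁} g_{u₁} + f_{u₂} g_{v₂} − f_{v₂} g_{u₂}`
on `ℂ[u₁,u₂,v₁,v₂]` (variables indexed `u₁ = 0, u₂ = 1, v₁ = 2, v₂ = 3`), corresponding
to the symplectic form `du₁∧dv₁ + du₂∧dv₂`. -/
noncomputable def poissonBracket (f g : MvPolynomial (Fin 4) ℂ) : MvPolynomial (Fin 4) ℂ :=
  pderiv 0 f * pderiv 2 g - pderiv 2 f * pderiv 0 g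
    + pderiv 1 f * pderiv 3 g - pderiv 3 f * pderiv 1 g

noncomputable def x₁' (r : ℕ) : MvPolynomial (Fin 4) ℂ :=
  (X 0 * X 2 - X 1 * X 3) ^ (r - 1) * (X 0 - (-1) ^ r * X 1)
noncomputable def y₁' (r : ℕ) : MvPolynomial (Fin 4) ℂ :=
  (X 0 * X 2 - X 1 * X 3) ^ (r - 1) * (X 2 - (-1) ^ r * X 3)
noncomputable def x₂' (r : ℕ) : MvPolynomial (Fin 4) ℂ := (-1) ^ r * X 0 * X 1
noncomputable def y₂' (r : ℕ) : MvPolynomial (Fin 4) ℂ := (-1) ^ r * X 2 * X 3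
noncomputable def w' : MvPolynomial (Fin 4) ℂ := X 0 * X 2 + X 1 * X 3

/-- The Poisson brackets among the five generators `x₁, y₁, x₂, y₂, w` of the Coulomb
branch ring `ℂ[M_C(r,2,1)]` expressed in the étale coordinates: `{x₂,y₂} = w`,
`{w,x₂} = −2x₂`, `{w,y₂} = 2y₂`, `{y₂,x₁} = y₁`, `{y₂,y₁} = 0`, `{x₂,x₁} = 0`,
`{x₂,y₁} = −x₁`, `{w,x₁} = −x₁`, `{w,y₁} = y₁`. -/
theorem coulomb_poisson_brackets (r : ℕ) (hr : 1 ≤ r) :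
    poissonBracket (x₂' r) (y₂' r) = w' ∧
    poissonBracket w' (x₂' r) = -2 * x₂' r ∧
    poissonBracket w' (y₂' r) = 2 * y₂' r ∧
    poissonBracket (y₂' r) (x₁' r) = y₁' r ∧
    poissonBracket (y₂' r) (y₁' r) = 0 ∧
    poissonBracket (x₂' r) (x₁' r) = 0 ∧
    poissonBracket (x₂' r) (y₁' r) = -x₁' r ∧
    poissonBracket w' (x₁' r) = -x₁' r ∧
    poissonBracket w' (y₁' r) = y₁' r := by
  have h01 : (0 : Fin 4) ≠ 1 := by decide
  have h02 : (0 : Fin 4) ≠ 2 := by decide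
  have h03 : (0 : Fin 4) ≠ 3 := by decide
  have h12 : (1 : Fin 4) ≠ 2 := by decide
  have h13 : (1 : Fin 4) ≠ 3 := by decide
  have h23 : (2 : Fin 4) ≠ 3 := by decide
  unfold poissonBracket x₁' y₁' x₂' y₂' w'
  generalize r - 1 = n
  rcases neg_one_pow_eq_or (MvPolynomial (Fin 4) ℂ) r with h | h <;> rw [h] <;>
  refine ⟨?_, ?_, ?_, ?_, ?_, ?_, ?_, ?_, ?_⟩ <;>
  simp only [Derivation.leibniz, Derivation.leibniz_pow, map_sub, map_add, map_neg, map_one,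
    Derivation.map_one_eq_zero, pderiv_X_self, pderiv_X_of_ne h01, pderiv_X_of_ne h02,
    pderiv_X_of_ne h03, pderiv_X_of_ne h12, pderiv_X_of_ne h13, pderiv_X_of_ne h23,
    pderiv_X_of_ne h01.symm, pderiv_X_of_ne h02.symm, pderiv_X_of_ne h03.symm,
    pderiv_X_of_ne h12.symm, pderiv_X_of_ne h13.symm, pderiv_X_of_ne h23.symm,
    smul_eq_mul, nsmul_eq_mul] <;>
  ring
end

section
/- Let r ≥ 2 be an integer, let x₁, y₁, x₂, y₂, w, b₁, …, b_{r−1} be arbitrary complex numbers, and let c ∈ ℂ satisfy 2·(2r−3)!·c² = 1. Let A be the 2r × 2r matrix with entries: A_{i,i+1} = i for 1 ≤ i ≤ 2r−3; A_{j+2k−1, j} = binom(2r−2−j, 2k−1)·b_k for all integers j ≥ 1, k ≥ 1 with j+2k−1 ≤ 2r−2; A_{2r−2,2r−1} = c·y₁, A_{2r−2,2r} = c·x₁; A_{2r−1,1} = −c·x₁, A_{2r,1} = c·y₁; A_{2r−1,2r−1} = w, A_{2r−1,2r} = −2x₂, A_{2r,2r−1} = 2y₂, A_{2r,2r} = −w;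 all other entries 0. Let Ω be the 2r × 2r matrix with Ω_{i,2r−1−i} = (−1)^i·binom(2r−3,i−1)^{−1} for 1 ≤ i ≤ 2r−2, Ω_{2r−1,2r} = −1, Ω_{2r,2r−1} = 1, other entries 0, let e have entries e_{i,i+1} = i for 1 ≤ i ≤ 2r−3 and 0 otherwise, and let f have entries f_{i+1,i} = 2r−2−i for 1 ≤ i ≤ 2r−3 and 0 otherwise. Then Ω·A + Aᵀ·Ω = 0 and f·(A−e) = (A−e)·f; i.e., A lies in e + Z_{sp(2r)}(f), the Slodowy slice to the orbit of e. -/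
open Matrix

/-- The matrix `A = A(x₁,y₁,x₂,y₂,w,b₁,…,b_{r−1})` parametrizing the Slodowy slice
`𝕊(2r−2,1,1) = e + Z_{sp(2r)}(f)`, in 1-based indexing: `A_{i,i+1} = i` for
`1 ≤ i ≤ 2r−3`; `A_{j+2k−1,j} = binom(2r−2−j, 2k−1)·b_k` for `j, k ≥ 1`,
`j+2k−1 ≤ 2r−2`; `A_{2r−2,2r−1} = c·y₁`, `A_{2r−2,2r} = c·x₁`; `A_{2r−1,1} = −c·x₁`,
`A_{2r,1} = c·y₁`; `A_{2r−1,2r−1} = w`, `A_{2r−1,2r} = −2x₂`, `A_{2r,2r−1} = 2y₂`,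
`A_{2r,2r} = −w`; all other entries `0`. -/
noncomputable def AMat (r : ℕ) (x₁ y₁ x₂ y₂ w c : ℂ) (b : ℕ → ℂ) :
    Matrix (Fin (2 * r)) (Fin (2 * r)) ℂ :=
  Matrix.of fun i j =>
    if (i : ℕ) + 1 ≤ 2 * r - 3 ∧ (j : ℕ) = (i : ℕ) + 1 then ((i : ℕ) + 1 : ℂ)
    else if (i : ℕ) + 1 ≤ 2 * r - 2 ∧ (j : ℕ) < (i : ℕ) ∧ Odd ((i : ℕ) - (j : ℕ)) then
      (Nat.choose (2 * r - 2 - ((j : ℕ) + 1)) ((i : ℕ) - (j : ℕ)) : ℂ) *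
        b (((i : ℕ) - (j : ℕ) + 1) / 2)
    else if (i : ℕ) + 1 = 2 * r - 2 ∧ (j : ℕ) + 1 = 2 * r - 1 then c * y₁
    else if (i : ℕ) + 1 = 2 * r - 2 ∧ (j : ℕ) + 1 = 2 * r then c * x₁
    else if (i : ℕ) + 1 = 2 * r - 1 ∧ (j : ℕ) + 1 = 1 then -c * x₁
    else if (i : ℕ) + 1 = 2 * r ∧ (j : ℕ) + 1 = 1 then c * y₁
    else if (i : ℕ) + 1 = 2 * r - 1 ∧ (j : ℕ) + 1 = 2 * r - 1 then w
    else if (i : ℕ) + 1 = 2 * r - 1 ∧ (j : ℕ) + 1 = 2 * r then -2 * x₂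
    else if (i : ℕ) + 1 = 2 * r ∧ (j : ℕ) + 1 = 2 * r - 1 then 2 * y₂
    else if (i : ℕ) + 1 = 2 * r ∧ (j : ℕ) + 1 = 2 * r then -w
    else 0

/-- The matrix `Ω` of the symplectic form. -/
noncomputable def ΩMat (r : ℕ) : Matrix (Fin (2 * r)) (Fin (2 * r)) ℂ :=
  Matrix.of fun i j =>
    if (i : ℕ) + 1 ≤ 2 * r - 2 ∧ (j : ℕ) + 1 = 2 * r - 1 - ((i : ℕ) + 1) then
      (-1 : ℂ) ^ ((i : ℕ) + 1) * ((Nat.choose (2 * r - 3) (i : ℕ) : ℂ))⁻¹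
    else if (i : ℕ) + 1 = 2 * r - 1 ∧ (j : ℕ) + 1 = 2 * r then -1
    else if (i : ℕ) + 1 = 2 * r ∧ (j : ℕ) + 1 = 2 * r - 1 then 1
    else 0

/-- The matrix `e`. -/
noncomputable def eMat (r : ℕ) : Matrix (Fin (2 * r)) (Fin (2 * r)) ℂ :=
  Matrix.of fun i j =>
    if (i : ℕ) + 1 ≤ 2 * r - 3 ∧ (j : ℕ) = (i : ℕ) + 1 then ((i : ℕ) + 1 : ℂ) else 0

/-- The matrix `f`. -/
noncomputable def fMat (r : ℕ) : Matrix (Fin (2 * r)) (Fin (2 * r)) ℂ :=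
  Matrix.of fun i j =>
    if (j : ℕ) + 1 ≤ 2 * r - 3 ∧ (i : ℕ) = (j : ℕ) + 1 then
      ((2 * r : ℂ) - 3 - (j : ℕ)) else 0

/-- The index paired with `k` by the form. -/
def sig (N k : ℕ) : ℕ := if k ≤ N then N - k else if k = N + 1 then N + 2 else N + 1

/-- The value of the form at `(k, sig k)`. -/
noncomputable def om (N k : ℕ) : ℂ :=
  if k ≤ N then (-1 : ℂ) ^ (k + 1) * ((Nat.choose N k : ℂ))⁻¹ else if k = N + 1 then -1 else 1

theorem sig_lt (N k : ℕ) : sig N k < N + 3 := by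
  unfold sig; split_ifs <;> omega

theorem Om_apply (r N : ℕ) (h : 2 * r = N + 3) (i j : Fin (2 * r)) :
    ΩMat r i j = if (j : ℕ) = sig N i then om N i else 0 := by
  have hi := i.2
  have hj := j.2
  have h3 : 2 * r - 3 = N := by omega
  simp only [ΩMat, Matrix.of_apply, sig, om, h3]
  split_ifs <;> first | rfl | omega

theorem sig_sig (N k : ℕ) (hk : k < N + 3) : sig N (sig N k) = k := by
  unfold sig; split_ifs <;> omega

/-- The entries of `A`. -/
noncomputable def aa (N : ℕ) (x₁ y₁ x₂ y₂ w c : ℂ) (b : ℕ → ℂ) (i j : ℕ) : ℂ :=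
  if i ≤ N then
    if j ≤ N then
      if j = i + 1 then (i + 1 : ℂ)
      else if j < i ∧ (i - j) % 2 = 1 then (Nat.choose (N - j) (i - j) : ℂ) * b ((i - j + 1) / 2)
      else 0
    else if i = N then if j = N + 1 then c * y₁ else c * x₁ else 0
  else if i = N + 1 then
    if j = 0 then -c * x₁ else if j = N + 1 then w else if j = N + 2 then -2 * x₂ else 0
  else
    if j = 0 then c * y₁ else if j = N + 1 then 2 * y₂ else if j = N + 2 then -w else 0

set_option maxHeartbeats 2000000 in
theorem A_apply (r N : ℕ) (h : 2 * r = N + 3) (x₁ y₁ x₂ y₂ w c : ℂ) (b : ℕ → ℂ)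
    (i j : Fin (2 * r)) :
    AMat r x₁ y₁ x₂ y₂ w c b i j = aa N x₁ y₁ x₂ y₂ w c b i j := by
  have hi := i.2
  have hj := j.2
  have h3 : 2 * r - 2 - ((j : ℕ) + 1) = N - j := by omega
  simp only [AMat, Matrix.of_apply, aa, h3, Nat.odd_iff]
  generalize (i : ℕ) = i at *
  generalize (j : ℕ) = j at *
  split_ifs <;> first | rfl | omega

theorem e_apply (r N : ℕ) (h : 2 * r = N + 3) (i j : Fin (2 * r)) :
    eMat r i j = if (i : ℕ) + 1 ≤ N ∧ (j : ℕ) = i + 1 then ((i : ℕ) + 1 : ℂ) else 0 := by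
  have h3 : 2 * r - 3 = N := by omega
  simp only [eMat, Matrix.of_apply, h3]

theorem choose_symm3 (N i j : ℕ) (h : i + j ≤ N) :
    N.choose i * (N - i).choose (N - i - j) = N.choose j * (N - j).choose (N - i - j) := by
  obtain ⟨d, rfl⟩ := Nat.exists_eq_add_of_le h
  have e1 : i + j + d - i - j = d := by omega
  have e2 : i + j + d - i = d + j := by omega
  have e3 : i + j + d - j = d + i := by omega
  rw [e1, e2, e3]
  have a1 := Nat.add_choose_mul_factorial_mul_factorial (d + j) i
  have a2 := Nat.add_choose_mul_factorial_mul_factorial (d + i) j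
  have a3 := Nat.add_choose_mul_factorial_mul_factorial d j
  have a4 := Nat.add_choose_mul_factorial_mul_factorial d i
  rw [← a3] at a1
  rw [← a4, show d + i + j = d + j + i by ring, ← a1] at a2
  rw [Nat.choose_symm_add, Nat.choose_symm_add, show i + j + d = d + j + i by ring]
  have : 0 < d.factorial * i.factorial * j.factorial := by positivity
  apply Nat.eq_of_mul_eq_mul_right this
  linarith

theorem block_b (N i j : ℕ) (hN : N % 2 = 1) (h : i + j ≤ N) (h2 : (N - i - j) % 2 = 1) :
    (-1 : ℂ) ^ (i + 1) * ((Nat.choose N i : ℂ))⁻¹ * ((N - j).choose (N - i - j) : ℂ) +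
      ((N - i).choose (N - i - j) : ℂ) * ((-1 : ℂ) ^ (N - j + 1) * ((Nat.choose N j : ℂ))⁻¹) = 0 := by
  have hs := choose_symm3 N i j h
  have c1 : (N.choose i : ℂ) ≠ 0 := by exact_mod_cast (Nat.choose_pos (by omega)).ne'
  have c2 : (N.choose j : ℂ) ≠ 0 := by exact_mod_cast (Nat.choose_pos (by omega)).ne'
  have hs' : (N.choose i : ℂ) * (N - i).choose (N - i - j)
      = N.choose j * (N - j).choose (N - i - j) := by exact_mod_cast hs
  have hsg : (-1 : ℂ) ^ (N - j + 1) = - (-1 : ℂ) ^ (i + 1) := by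
    have : N - j + 1 = (i + 1) + (2 * ((N - i - j) / 2) + 1) := by omega
    rw [this, pow_add, pow_succ _ (2 * _), pow_mul]; simp
  rw [hsg]
  field_simp
  linear_combination (- (-1 : ℂ) ^ (i + 1)) * hs'

theorem block_e (N i j : ℕ) (hN : N % 2 = 1) (h : i + j = N + 1) (hi : 1 ≤ i) (hj : 1 ≤ j) :
    (-1 : ℂ) ^ (i + 1) * ((Nat.choose N i : ℂ))⁻¹ * (j : ℂ) +
      (i : ℂ) * ((-1 : ℂ) ^ (N - j + 1) * ((Nat.choose N j : ℂ))⁻¹) = 0 := by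
  have c1 : (N.choose i : ℂ) ≠ 0 := by exact_mod_cast (Nat.choose_pos (by omega)).ne'
  have c2 : (N.choose j : ℂ) ≠ 0 := by exact_mod_cast (Nat.choose_pos (by omega)).ne'
  obtain ⟨k, rfl⟩ := Nat.exists_eq_add_of_le' hi
  have hk := Nat.choose_succ_right_eq N k
  have e1 : N - k = j := by omega
  have e2 : N.choose k = N.choose j := by rw [← e1, Nat.choose_symm (by omega)]
  rw [e1, e2] at hk
  have hk' : (N.choose (k+1) : ℂ) * (k + 1 : ℕ) = N.choose j * j := by exact_mod_cast hk
  have e3 : N - j + 1 = k + 1 := by omega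
  rw [e3]
  field_simp
  linear_combination ((-1 : ℂ) ^ (k + 1)) * hk'

theorem sp_entry (N i j : ℕ) (hN : N % 2 = 1) (hi : i < N + 3) (hj : j < N + 3)
    (x₁ y₁ x₂ y₂ w c : ℂ) (b : ℕ → ℂ) :
    om N i * aa N x₁ y₁ x₂ y₂ w c b (sig N i) j +
      aa N x₁ y₁ x₂ y₂ w c b (sig N j) i * om N (sig N j) = 0 := by
  have o1 : om N (N + 1) = -1 := by simp [om]
  have o2 : om N (N + 2) = 1 := by simp [om]
  have o0 : om N 0 = -1 := by simp [om]
  have oN : om N N = 1 := by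
    have : Even (N + 1) := by rw [Nat.even_iff]; omega
    simp [om, this]
  by_cases hi1 : i ≤ N
  · have si : sig N i = N - i := by simp [sig, hi1]
    by_cases hj1 : j ≤ N
    · have sj : sig N j = N - j := by simp [sig, hj1]
      have oi : om N i = (-1 : ℂ) ^ (i + 1) * ((Nat.choose N i : ℂ))⁻¹ := by simp [om, hi1]
      have oj : om N (N - j) = (-1 : ℂ) ^ (N - j + 1) * ((Nat.choose N j : ℂ))⁻¹ := by
        simp [om, Nat.choose_symm hj1]
      rw [si, sj, oi, oj]
      by_cases h1 : i + j = N + 1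
      · have := block_e N i j hN h1 (by omega) (by omega)
        have q1 : aa N x₁ y₁ x₂ y₂ w c b (N - i) j = j := by
          unfold aa
          rw [if_pos (by omega), if_pos hj1, if_pos (by omega)]
          exact_mod_cast (by omega : N - i + 1 = j)
        have q2 : aa N x₁ y₁ x₂ y₂ w c b (N - j) i = i := by
          unfold aa
          rw [if_pos (by omega), if_pos hi1, if_pos (by omega)]
          exact_mod_cast (by omega : N - j + 1 = i)
        rw [q1, q2, this]
      · by_cases h2 : i + j ≤ N ∧ (N - i - j) % 2 = 1
        · have := block_b N i j hN h2.1 h2.2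
          have e : N - j - i = N - i - j := by omega
          unfold aa
          rw [if_pos (by omega), if_pos hj1, if_neg (by omega), if_pos (by omega),
            if_pos (by omega), if_pos hi1, if_neg (by omega), if_pos (by omega), e]
          linear_combination (b ((N - i - j + 1) / 2)) * this
        · unfold aa
          rw [if_pos (by omega), if_pos hj1, if_neg (by omega), if_neg (by omega),
            if_pos (by omega), if_pos hi1, if_neg (by omega), if_neg (by omega)]
          ring
    · obtain rfl | rfl : j = N + 1 ∨ j = N + 2 := by omega
      · have sj : sig N (N + 1) = N + 2 := by simp [sig]
        rw [si, sj, o2]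
        by_cases h0 : i = 0
        · subst h0; rw [o0]; simp [aa]
        · have : ¬ N - i = N := by omega
          simp [aa, this, h0, hi1, show i ≠ N + 1 by omega, show i ≠ N + 2 by omega]
      · have sj : sig N (N + 2) = N + 1 := by simp [sig]
        rw [si, sj, o1]
        by_cases h0 : i = 0
        · subst h0; rw [o0]; simp [aa]
        · have : ¬ N - i = N := by omega
          simp [aa, this, h0, hi1, show i ≠ N + 1 by omega, show i ≠ N + 2 by omega]
  · have s1 : sig N (N + 1) = N + 2 := by simp [sig]
    have s2 : sig N (N + 2) = N + 1 := by simp [sig]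
    by_cases hj1 : j ≤ N
    · have sj : sig N j = N - j := by simp [sig, hj1]
      obtain rfl | rfl : i = N + 1 ∨ i = N + 2 := by omega
      · rw [sj, s1, o1]
        by_cases h0 : j = 0
        · subst h0; simp [aa, oN]
        · have : ¬ N - j = N := by omega
          simp [aa, this, h0, show j ≠ N + 1 by omega, show j ≠ N + 2 by omega]
      · rw [sj, s2, o2]
        by_cases h0 : j = 0
        · subst h0; simp [aa, oN]
        · have : ¬ N - j = N := by omega
          simp [aa, this, h0, show j ≠ N + 1 by omega, show j ≠ N + 2 by omega]
    · obtain rfl | rfl : i = N + 1 ∨ i = N + 2 := by omega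
      all_goals obtain rfl | rfl : j = N + 1 ∨ j = N + 2 := by omega
      all_goals simp [aa, s1, s2, o1, o2]

/-- The entries of `A - e`. -/
noncomputable def mm (N : ℕ) (x₁ y₁ x₂ y₂ w c : ℂ) (b : ℕ → ℂ) (i j : ℕ) : ℂ :=
  aa N x₁ y₁ x₂ y₂ w c b i j - if i + 1 ≤ N ∧ j = i + 1 then (i + 1 : ℂ) else 0

theorem mm_block (N : ℕ) (x₁ y₁ x₂ y₂ w c : ℂ) (b : ℕ → ℂ) (i j : ℕ) (hi : i ≤ N) (hj : j ≤ N) :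
    mm N x₁ y₁ x₂ y₂ w c b i j = if j < i ∧ (i - j) % 2 = 1 then
      (Nat.choose (N - j) (i - j) : ℂ) * b ((i - j + 1) / 2) else 0 := by
  unfold mm aa
  split_ifs <;> first | contradiction | omega | simp

theorem choose_f (m d : ℕ) (h : d ≤ m) :
    ((m + 1 : ℕ) - d : ℂ) * (m + 1).choose d = (m.choose d : ℂ) * (m + 1 : ℕ) := by
  have := Nat.choose_mul_succ_eq m d
  have h2 : ((m + 1 - d : ℕ) : ℂ) = (m + 1 : ℕ) - d := Nat.cast_sub (by omega)
  rw [← h2, mul_comm]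
  exact_mod_cast this.symm

theorem f_apply (r N : ℕ) (h : 2 * r = N + 3) (i j : Fin (2 * r)) :
    fMat r i j = if (j : ℕ) + 1 ≤ N ∧ (i : ℕ) = j + 1 then ((N : ℂ) - (j : ℕ)) else 0 := by
  have h3 : 2 * r - 3 = N := by omega
  have h4 : (2 * r : ℂ) = N + 3 := by exact_mod_cast h
  simp only [fMat, Matrix.of_apply, h3, h4]
  congr 1
  ring

theorem f_entry (N i j : ℕ) (hi : i < N + 3) (hj : j < N + 3)
    (x₁ y₁ x₂ y₂ w c : ℂ) (b : ℕ → ℂ) :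
    (if 1 ≤ i ∧ i ≤ N then ((N : ℂ) - (i - 1 : ℕ)) * mm N x₁ y₁ x₂ y₂ w c b (i - 1) j else 0) =
    (if j + 1 ≤ N then mm N x₁ y₁ x₂ y₂ w c b i (j + 1) * ((N : ℂ) - (j : ℕ)) else 0) := by
  by_cases h1 : 1 ≤ i ∧ i ≤ N
  · rw [if_pos h1]
    by_cases h2 : j + 1 ≤ N
    · rw [if_pos h2, mm_block _ _ _ _ _ _ _ _ _ _ (by omega) (by omega),
        mm_block _ _ _ _ _ _ _ _ _ _ (by omega) (by omega)]
      by_cases h3 : j < i - 1 ∧ (i - 1 - j) % 2 = 1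
      · rw [if_pos h3, if_pos (by omega)]
        obtain ⟨m, hm⟩ := Nat.exists_eq_add_of_le' h2
        obtain ⟨d, hd⟩ := Nat.exists_eq_add_of_le h3.1
        have e1 : i - 1 - j = d + 1 := by omega
        have e2 : i - (j + 1) = d + 1 := by omega
        have e3 : N - j = m + 1 := by omega
        have e4 : N - (j + 1) = m := by omega
        have := choose_f m (d + 1) (by omega)
        rw [e1, e2, e3, e4, hd, hm]
        push_cast at this ⊢
        linear_combination b ((d + 1 + 1) / 2) * this
      · rw [if_neg h3, if_neg (by omega)]; ring
    · rw [if_neg h2]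
      unfold mm aa
      split_ifs <;> first | contradiction | omega | simp
  · rw [if_neg h1]
    split_ifs with h2
    · unfold mm aa
      split_ifs <;> first | contradiction | omega | simp
    · rfl

/-- The matrix `A(x₁,y₁,x₂,y₂,w,b₁,…,b_{r−1})` lies in `e + Z_{sp(2r)}(f)`, i.e. in the
Slodowy slice `𝕊(2r−2,1,1)`: `ΩA + AᵀΩ = 0` and `f·(A−e) = (A−e)·f`. -/
theorem AMat_mem_slodowy_slice (r : ℕ) (hr : 2 ≤ r)
    (x₁ y₁ x₂ y₂ w c : ℂ) (b : ℕ → ℂ)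
    (hc : 2 * ((2 * r - 3).factorial : ℂ) * c ^ 2 = 1) :
    ΩMat r * AMat r x₁ y₁ x₂ y₂ w c b + (AMat r x₁ y₁ x₂ y₂ w c b)ᵀ * ΩMat r = 0 ∧
    fMat r * (AMat r x₁ y₁ x₂ y₂ w c b - eMat r) =
      (AMat r x₁ y₁ x₂ y₂ w c b - eMat r) * fMat r := by
  obtain ⟨N, h⟩ : ∃ N, 2 * r = N + 3 := ⟨2 * r - 3, by omega⟩
  have hN : N % 2 = 1 := by omega
  have hM : ∀ i j : Fin (2 * r), (AMat r x₁ y₁ x₂ y₂ w c b - eMat r) i j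
      = mm N x₁ y₁ x₂ y₂ w c b i j := by
    intro i j
    rw [Matrix.sub_apply, A_apply r N h, e_apply r N h, mm]
  constructor
  · ext i j
    have hi : (i : ℕ) < N + 3 := h ▸ i.2
    have hj : (j : ℕ) < N + 3 := h ▸ j.2
    have key := sp_entry N i j hN hi hj x₁ y₁ x₂ y₂ w c b
    let si : Fin (2 * r) := ⟨sig N i, by have := sig_lt N i; omega⟩
    let sj : Fin (2 * r) := ⟨sig N j, by have := sig_lt N j; omega⟩
    rw [Matrix.add_apply, Matrix.mul_apply, Matrix.mul_apply, Finset.sum_eq_single si,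
      Finset.sum_eq_single sj]
    · rw [Matrix.transpose_apply, Om_apply r N h, Om_apply r N h, A_apply r N h, A_apply r N h,
        if_pos rfl, if_pos (sig_sig N j hj).symm]
      exact key
    · intro k _ hk
      rw [Om_apply r N h, if_neg, mul_zero]
      intro hh
      apply hk
      apply Fin.ext
      have := sig_sig N k (h ▸ k.2)
      change (k : ℕ) = sig N j
      rw [hh, this]
    · simp
    · intro k _ hk
      rw [Om_apply r N h, if_neg, zero_mul]
      intro hh
      exact hk (Fin.ext hh)
    · simp
  · ext i j
    have hi : (i : ℕ) < N + 3 := h ▸ i.2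
    have hj : (j : ℕ) < N + 3 := h ▸ j.2
    have key := f_entry N i j hi hj x₁ y₁ x₂ y₂ w c b
    rw [Matrix.mul_apply, Matrix.mul_apply]
    simp only [hM, f_apply r N h]
    refine Eq.trans ?_ (key.trans ?_)
    · by_cases h1 : 1 ≤ (i : ℕ) ∧ (i : ℕ) ≤ N
      · rw [if_pos h1, Finset.sum_eq_single (⟨(i : ℕ) - 1, by omega⟩ : Fin (2 * r))]
        · rw [if_pos]
          dsimp only
          omega
        · intro k _ hk
          rw [if_neg, zero_mul]
          intro hh
          apply hk
          apply Fin.ext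
          dsimp only
          omega
        · simp
      · rw [if_neg h1]
        apply Finset.sum_eq_zero
        intro k _
        rw [if_neg (by omega), zero_mul]
    · by_cases h1 : (j : ℕ) + 1 ≤ N
      · rw [if_pos h1, Finset.sum_eq_single (⟨(j : ℕ) + 1, by omega⟩ : Fin (2 * r))]
        · rw [if_pos ⟨h1, rfl⟩]
        · intro k _ hk
          rw [if_neg, mul_zero]
          intro hh
          exact hk (Fin.ext hh.2)
        · simp
      · rw [if_neg h1]
        symm
        apply Finset.sum_eq_zero
        intro k _
        rw [if_neg (by omega), mul_zero]
end

section
/- Let r ≥ 2 be an integer, let x₁, y₁, x₂, y₂, w, b₁, …, b_{r−1} be arbitrary complex numbers, and let c ∈ ℂ satisfy 2·(2r−3)!·c² = 1. Let A be the 2r × 2r matrix with entries: A_{i,i+1} = i for 1 ≤ i ≤ 2r−3; A_{j+2k−1, j} = binom(2r−2−j, 2k−1)·b_k for all integers j ≥ 1, k ≥ 1 with j+2k−1 ≤ 2r−2; A_{2r−2,2r−1} = c·y₁, A_{2r−2,2r} = c·x₁; A_{2r−1,1} = −c·x₁, A_{2r,1} = c·y₁; A_{2r−1,2r−1} = w,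 A_{2r−1,2r} = −2x₂, A_{2r,2r−1} = 2y₂, A_{2r,2r} = −w; all other entries 0. Let B be the upper-left (2r−2) × (2r−2) submatrix of A. Then det A = (x₁²y₂ + x₂y₁² + w·x₁y₁) − (w²−4x₂y₂)·det B. -/
open Matrix

/-- The upper-left `(2r−2) × (2r−2)` submatrix of `A`. -/
noncomputable def BMat (r : ℕ) (x₁ y₁ x₂ y₂ w c : ℂ) (b : ℕ → ℂ) :
    Matrix (Fin (2 * r - 2)) (Fin (2 * r - 2)) ℂ :=
  (AMat r x₁ y₁ x₂ y₂ w c b).submatrix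
    (Fin.castLE (by omega : 2 * r - 2 ≤ 2 * r)) (Fin.castLE (by omega : 2 * r - 2 ≤ 2 * r))


lemma aux_rank1 (m : ℕ) (B : Matrix (Fin (m+1)) (Fin (m+1)) ℂ) (s : ℂ)
    (h1 : ∀ i j : Fin (m+1), (i : ℕ) + 1 < j → B i j = 0)
    (h2 : ∀ i j : Fin (m+1), (j : ℕ) = i + 1 → B i j = (i : ℕ) + 1) :
    (B - Matrix.of fun i j => if i = Fin.last m ∧ j = 0 then s else 0).det
      = B.det - s * ((-1) ^ m * (m.factorial : ℂ)) := by
  have e : (B - Matrix.of fun i j => if i = Fin.last m ∧ j = 0 then s else 0)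
      = B.updateRow (Fin.last m) (B (Fin.last m) + (-s) • (Pi.single 0 1)) := by
    ext i j
    by_cases hi : i = Fin.last m
    · subst hi
      by_cases hj : j = 0
      · subst hj; simp [sub_eq_add_neg]
      · simp [hj]
    · simp [hi]
  rw [e, det_updateRow_add, det_updateRow_smul, updateRow_eq_self, ← adjugate_apply,
    adjugate_fin_succ_eq_det_submatrix]
  have t : (B.submatrix (Fin.last m).succAbove (0 : Fin (m+1)).succAbove).det
      = (m.factorial : ℂ) := by
    rw [det_of_isLowerTriangular]
    · have : ∀ i : Fin m, (B.submatrix (Fin.last m).succAbove (0 : Fin (m+1)).succAbove) i i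
          = (((i : ℕ) + 1 : ℕ) : ℂ) := by
        intro i
        rw [submatrix_apply, h2] <;> simp
      rw [Finset.prod_congr rfl (fun i _ => this i), Fin.prod_univ_eq_prod_range
        (fun i => ((i + 1 : ℕ) : ℂ)) m, ← Nat.cast_prod, Finset.prod_range_add_one_eq_factorial]
    · intro i j hij
      rw [submatrix_apply, h1]
      simpa using hij
  rw [t]
  simp
  ring

lemma aux_blk (m : ℕ) (B : Matrix (Fin (m+1)) (Fin (m+1)) ℂ) (p1 p2 q1 q2 a b c d : ℂ)
    (hD : a * d - b * c ≠ 0)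
    (h1 : ∀ i j : Fin (m+1), (i : ℕ) + 1 < j → B i j = 0)
    (h2 : ∀ i j : Fin (m+1), (j : ℕ) = i + 1 → B i j = (i : ℕ) + 1) :
    (fromBlocks B (Matrix.of fun i j => if i = Fin.last m then ![p1, p2] j else 0)
      (Matrix.of fun i j => if j = 0 then ![q1, q2] i else 0) !![a, b; c, d]).det
      = (a * d - b * c) * B.det - (p1 * (d * q1 - b * q2) + p2 * (a * q2 - c * q1))
          * ((-1) ^ m * (m.factorial : ℂ)) := by
  have hu : IsUnit (!![a, b; c, d] : Matrix (Fin 2) (Fin 2) ℂ).det := by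
    rw [det_fin_two_of]; exact hD.isUnit
  have := invertibleOfIsUnitDet _ hu
  rw [det_fromBlocks₂₂, det_fin_two_of, invOf_eq_nonsing_inv]
  have e : (Matrix.of fun (i : Fin (m+1)) j => if i = Fin.last m then ![p1, p2] j else 0)
      * (!![a, b; c, d])⁻¹ * (Matrix.of fun i (j : Fin (m+1)) => if j = 0 then ![q1, q2] i else 0)
      = Matrix.of fun i j => if i = Fin.last m ∧ j = 0 then
        (p1 * (d * q1 - b * q2) + p2 * (a * q2 - c * q1)) / (a * d - b * c) else 0 := by
    ext i j
    rw [inv_def, adjugate_fin_two_of, det_fin_two_of]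
    by_cases hi : i = Fin.last m <;> by_cases hj : j = 0 <;>
      simp [Matrix.mul_apply, Fin.sum_univ_two, hi, hj]
    field_simp
    ring
  rw [e, aux_rank1 m B _ h1 h2]
  field_simp

lemma aux_ite (P : Prop) [Decidable P] {a e z : ℂ} (h1 : P → a = z) (h2 : ¬ P → e = z) :
    (if P then a else e) = z := by
  split_ifs with h
  · exact h1 h
  · exact h2 h

set_option maxHeartbeats 4000000 in
lemma aux_main (k : ℕ) (x₁ y₁ x₂ y₂ w c : ℂ) (b : ℕ → ℂ)
    (hD : w * (-w) - (-2 * x₂) * (2 * y₂) ≠ 0)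
    (hc : 2 * ((2 * (k+2) - 3).factorial : ℂ) * c ^ 2 = 1) :
    (AMat (k+2) x₁ y₁ x₂ y₂ w c b).det =
      (x₁ ^ 2 * y₂ + x₂ * y₁ ^ 2 + w * x₁ * y₁)
        - (w ^ 2 - 4 * x₂ * y₂) * (BMat (k+2) x₁ y₁ x₂ y₂ w c b).det := by
  have hn : 2 * k + 1 + 1 + 2 = 2 * (k + 2) := by ring
  have hn' : 2 * k + 1 + 1 = 2 * (k + 2) - 2 := by omega
  set B' := (BMat (k+2) x₁ y₁ x₂ y₂ w c b).submatrix (finCongr hn') (finCongr hn') with hB'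
  have hB : (BMat (k+2) x₁ y₁ x₂ y₂ w c b).det = B'.det := (det_submatrix_equiv_self _ _).symm
  have hA : (AMat (k+2) x₁ y₁ x₂ y₂ w c b).det = ((AMat (k+2) x₁ y₁ x₂ y₂ w c b).submatrix
    (finSumFinEquiv.trans (finCongr hn)) (finSumFinEquiv.trans (finCongr hn))).det :=
      (det_submatrix_equiv_self _ _).symm
  have hblk : (AMat (k+2) x₁ y₁ x₂ y₂ w c b).submatrix
    (finSumFinEquiv.trans (finCongr hn)) (finSumFinEquiv.trans (finCongr hn)) =
    fromBlocks B' (Matrix.of fun i j => if i = Fin.last (2*k+1) then ![c*y₁, c*x₁] j else 0)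
      (Matrix.of fun i j => if j = 0 then ![-c*x₁, c*y₁] i else 0) !![w, -2*x₂; 2*y₂, -w] := by
    ext i j
    rcases i with i | i <;> rcases j with j | j
    · simp [hB', BMat]
      rfl
    · have hi := i.2
      simp only [submatrix_apply, AMat, of_apply, fromBlocks_apply₁₂, Equiv.trans_apply,
        finSumFinEquiv_apply_left, finSumFinEquiv_apply_right, finCongr_apply, Fin.val_cast,
        Fin.val_castAdd, Fin.val_natAdd, Fin.ext_iff, Fin.val_last]
      fin_cases j
      all_goals
        simp only [Fin.zero_eta, Fin.mk_one, Fin.val_zero, Fin.val_one, cons_val_zero, cons_val_one]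
        repeat' (refine aux_ite _ (fun h => ?_) (fun h => ?_))
        all_goals first | (exfalso; omega) | (symm; first | exact if_pos (by omega) | exact if_neg (by omega)) | (symm; split_ifs; first | rfl | (exfalso; omega))
    · have hj := j.2
      simp only [submatrix_apply, AMat, of_apply, fromBlocks_apply₂₁, Equiv.trans_apply,
        finSumFinEquiv_apply_left, finSumFinEquiv_apply_right, finCongr_apply, Fin.val_cast,
        Fin.val_castAdd, Fin.val_natAdd, Fin.ext_iff, Fin.val_zero]
      fin_cases i
      all_goals
        simp only [Fin.zero_eta, Fin.mk_one, Fin.val_zero, Fin.val_one, cons_val_zero, cons_val_one]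
        repeat' (refine aux_ite _ (fun h => ?_) (fun h => ?_))
        all_goals first | (exfalso; omega) | (symm; first | exact if_pos (by omega) | exact if_neg (by omega)) | (symm; split_ifs; first | rfl | (exfalso; omega))
    · simp only [submatrix_apply, AMat, of_apply, fromBlocks_apply₂₂, Equiv.trans_apply,
        finSumFinEquiv_apply_left, finSumFinEquiv_apply_right, finCongr_apply, Fin.val_cast,
        Fin.val_castAdd, Fin.val_natAdd]
      fin_cases i <;> fin_cases j
      all_goals
        simp
        repeat' (first | rw [if_pos (by omega)] | rw [if_neg (by omega)])
  rw [hA, hB, hblk, aux_blk _ _ _ _ _ _ _ _ _ _ hD]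
  · have h3 : 2 * (k+2) - 3 = 2 * k + 1 := by omega
    rw [h3] at hc
    rw [Odd.neg_one_pow ⟨k, rfl⟩]
    linear_combination (x₁ ^ 2 * y₂ + x₂ * y₁ ^ 2 + w * x₁ * y₁) * hc
  · intro i j hij
    have hi := i.2
    have hj := j.2
    simp only [hB', BMat, AMat, submatrix_apply, of_apply, finCongr_apply, Fin.val_castLE,
      Fin.val_cast]
    repeat' (first | rw [if_pos (by omega)] | rw [if_neg (by omega)])
  · intro i j hij
    have hi := i.2
    have hj := j.2
    simp only [hB', BMat, AMat, submatrix_apply, of_apply, finCongr_apply, Fin.val_castLE,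
      Fin.val_cast]
    rw [if_pos (by omega)]

lemma aux_cont (P : Prop) [Decidable P] {f g : ℂ → ℂ} (hf : Continuous f) (hg : Continuous g) :
    Continuous fun w => if P then f w else g w := by
  split_ifs <;> assumption

/-- The determinant identity on the Slodowy slice:
`det A = (x₁²y₂ + x₂y₁² + w·x₁y₁) − (w²−4x₂y₂)·det B`. -/
theorem det_AMat (r : ℕ) (hr : 2 ≤ r) (x₁ y₁ x₂ y₂ w c : ℂ) (b : ℕ → ℂ)
    (hc : 2 * ((2 * r - 3).factorial : ℂ) * c ^ 2 = 1) :
    (AMat r x₁ y₁ x₂ y₂ w c b).det =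
      (x₁ ^ 2 * y₂ + x₂ * y₁ ^ 2 + w * x₁ * y₁)
        - (w ^ 2 - 4 * x₂ * y₂) * (BMat r x₁ y₁ x₂ y₂ w c b).det := by
  obtain ⟨k, rfl⟩ : ∃ k, r = k + 2 := ⟨r - 2, by omega⟩
  have hcA : Continuous fun w => AMat (k+2) x₁ y₁ x₂ y₂ w c b := by
    refine continuous_matrix fun i j => ?_
    simp only [AMat, of_apply]
    repeat' (refine aux_cont _ ?_ ?_)
    all_goals fun_prop
  have hcB : Continuous fun w => BMat (k+2) x₁ y₁ x₂ y₂ w c b := by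
    unfold BMat
    exact hcA.matrix_submatrix _ _
  have hf : ({w : ℂ | w * (-w) - (-2 * x₂) * (2 * y₂) = 0}).Finite := by
    obtain ⟨z, hz⟩ := IsAlgClosed.exists_eq_mul_self (4 * x₂ * y₂)
    refine (Set.toFinite {z, -z}).subset fun w hw => ?_
    have : (w - z) * (w + z) = 0 := by
      simp only [Set.mem_ofPred_eq] at hw
      linear_combination -hw + hz
    rcases mul_eq_zero.1 this with h | h
    · left; linear_combination h
    · right; simp only [Set.mem_singleton_iff]; linear_combination h
  have hd : Dense ({w : ℂ | w * (-w) - (-2 * x₂) * (2 * y₂) = 0}ᶜ) := hf.countable.dense_compl ℂ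
  have key := Continuous.ext_on hd (f := fun w => (AMat (k+2) x₁ y₁ x₂ y₂ w c b).det)
    (g := fun w => (x₁ ^ 2 * y₂ + x₂ * y₁ ^ 2 + w * x₁ * y₁)
        - (w ^ 2 - 4 * x₂ * y₂) * (BMat (k+2) x₁ y₁ x₂ y₂ w c b).det)
    hcA.matrix_det
    (by have := hcB.matrix_det; fun_prop)
    (fun w hw => aux_main k x₁ y₁ x₂ y₂ w c b hw hc)
  exact congrFun key w
end

section
/- Let r ≥ 1 be an integer. In the field ℂ(u₁,u₂,w₁,w₂,z₁,…,z_r) of rational functions, set sx₁ = u₁(w₁−w₂)^{−1}∏_{i=1}^r (w₁−w₂−z_i) + u₂(w₂−w₁)^{−1}∏_{i=1}^r (w₂−w₁−z_i), sy₁ = u₁^{−1}w₁(w₁−w₂)^{−1}∏_{i=1}^r (w₁−w₂+z_i) + u₂^{−1}w₂(w₂−w₁)^{−1}∏_{i=1}^r (w₂−w₁+z_i), sx₂ = (−1)^r u₁u₂, sy₂ = (−1)^r w₁w₂u₁^{−1}u₂^{−1}, sw = w₁+w₂. Then sx₁²·sy₂ + sx₂·sy₁² + sw·sx₁·sy₁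 = Σ (−1)^{mn}·σ_m·σ_n·(sw²−4·sx₂·sy₂)^{r−(m+n)/2}, where the sum is over pairs of nonnegative integers (m,n) with m+n even and m+n ≤ 2r, and σ_k denotes the k-th elementary symmetric polynomial in z₁,…,z_r (σ₀ = 1, σ_k = 0 for k > r). -/
open MvPolynomial Finset

/-- The field of rational functions `ℂ(u₁,u₂,w₁,w₂,z₁,…,z_r)`: variables
`u₁ = inl 0, u₂ = inl 1, w₁ = inl 2, w₂ = inl 3` and `z_i = inr i`. -/
abbrev FlavorField (r : ℕ) : Type := FractionRing (MvPolynomial (Fin 4 ⊕ Fin r) ℂ)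

noncomputable def fu₁ (r : ℕ) : FlavorField r :=
  algebraMap (MvPolynomial (Fin 4 ⊕ Fin r) ℂ) _ (X (Sum.inl 0))
noncomputable def fu₂ (r : ℕ) : FlavorField r :=
  algebraMap (MvPolynomial (Fin 4 ⊕ Fin r) ℂ) _ (X (Sum.inl 1))
noncomputable def fw₁ (r : ℕ) : FlavorField r :=
  algebraMap (MvPolynomial (Fin 4 ⊕ Fin r) ℂ) _ (X (Sum.inl 2))
noncomputable def fw₂ (r : ℕ) : FlavorField r :=
  algebraMap (MvPolynomial (Fin 4 ⊕ Fin r) ℂ) _ (X (Sum.inl 3))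
noncomputable def fz (r : ℕ) (i : Fin r) : FlavorField r :=
  algebraMap (MvPolynomial (Fin 4 ⊕ Fin r) ℂ) _ (X (Sum.inr i))

/-- The `k`-th elementary symmetric polynomial `σ_k` in `z₁,…,z_r`
(`σ₀ = 1` and `σ_k = 0` for `k > r`). -/
noncomputable def fσ (r : ℕ) (k : ℕ) : FlavorField r :=
  ∑ S ∈ powersetCard k (univ : Finset (Fin r)), ∏ i ∈ S, fz r i

/-- The deformed generators of the flavor deformation of the Coulomb branch. -/
noncomputable def fsx₁ (r : ℕ) : FlavorField r :=
  fu₁ r * (fw₁ r - fw₂ r)⁻¹ * ∏ i : Fin r, (fw₁ r - fw₂ r - fz r i)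
    + fu₂ r * (fw₂ r - fw₁ r)⁻¹ * ∏ i : Fin r, (fw₂ r - fw₁ r - fz r i)
noncomputable def fsy₁ (r : ℕ) : FlavorField r :=
  (fu₁ r)⁻¹ * fw₁ r * (fw₁ r - fw₂ r)⁻¹ * ∏ i : Fin r, (fw₁ r - fw₂ r + fz r i)
    + (fu₂ r)⁻¹ * fw₂ r * (fw₂ r - fw₁ r)⁻¹ * ∏ i : Fin r, (fw₂ r - fw₁ r + fz r i)
noncomputable def fsx₂ (r : ℕ) : FlavorField r := (-1) ^ r * fu₁ r * fu₂ r
noncomputable def fsy₂ (r : ℕ) : FlavorField r :=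
  (-1) ^ r * fw₁ r * fw₂ r * (fu₁ r)⁻¹ * (fu₂ r)⁻¹
noncomputable def fsw (r : ℕ) : FlavorField r := fw₁ r + fw₂ r

theorem aux_prod (r : ℕ) (c d : FlavorField r) :
    ∏ i : Fin r, (d + c * fz r i) = ∑ k ∈ range (r + 1), c ^ k * fσ r k * d ^ (r - k) := by
  simp_rw [add_comm d]
  rw [Finset.prod_add, Finset.sum_powerset]
  simp only [card_univ, Fintype.card_fin]
  refine Finset.sum_congr rfl fun k _ => ?_
  rw [fσ, Finset.mul_sum, Finset.sum_mul]
  refine Finset.sum_congr rfl fun S hS => ?_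
  have hc := (mem_powersetCard.mp hS).2
  rw [Finset.prod_mul_distrib, Finset.prod_const, Finset.prod_const, hc,
    Finset.card_sdiff_of_subset (subset_univ S), hc]
  simp

theorem aux_σ (r k : ℕ) (h : r < k) : fσ r k = 0 := by
  rw [fσ, Finset.powersetCard_eq_empty.mpr (by simpa using h), Finset.sum_empty]

theorem aux_PQ (r : ℕ) (d : FlavorField r) :
    (∏ i : Fin r, (d - fz r i)) * ∏ i : Fin r, (d + fz r i) =
      ∑ p ∈ (range (2 * r + 1) ×ˢ range (2 * r + 1)).filter
          (fun p => Even (p.1 + p.2) ∧ p.1 + p.2 ≤ 2 * r),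
        (-1 : FlavorField r) ^ (p.1 * p.2) * fσ r p.1 * fσ r p.2 *
          (d ^ 2) ^ (r - (p.1 + p.2) / 2) := by
  have h1 := aux_prod r (-1) d
  have h2 := aux_prod r 1 d
  simp only [neg_mul, one_mul, ← sub_eq_add_neg, one_pow] at h1 h2
  rw [h1, h2, Finset.sum_mul_sum, ← Finset.sum_product',
    ← Finset.sum_filter_add_sum_filter_not _ (fun p : ℕ × ℕ => Even (p.1 + p.2))]
  have hodd : ∑ p ∈ (range (r + 1) ×ˢ range (r + 1)).filter
      (fun p : ℕ × ℕ => ¬ Even (p.1 + p.2)),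
      (-1 : FlavorField r) ^ p.1 * fσ r p.1 * d ^ (r - p.1) * (fσ r p.2 * d ^ (r - p.2)) = 0 := by
    refine Finset.sum_involution (fun p _ => (p.2, p.1)) ?_ ?_ ?_ ?_
    · rintro ⟨m, n⟩ h
      simp only [mem_filter, Nat.even_add] at h
      rcases Nat.even_or_odd m with hm | hm <;> rcases Nat.even_or_odd n with hn | hn
      · tauto
      · simp only [hm.neg_one_pow, hn.neg_one_pow]; ring
      · simp only [hm.neg_one_pow, hn.neg_one_pow]; ring
      · rw [← Nat.not_even_iff_odd] at hm hn; tauto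
    · rintro ⟨m, n⟩ h _ he
      simp only [mem_filter, Nat.even_add, Prod.mk.injEq] at h he
      rw [he.1] at h; tauto
    · rintro ⟨m, n⟩ h
      simp only [mem_filter, mem_product, add_comm n m] at h ⊢
      tauto
    · rintro ⟨m, n⟩ h; rfl
  rw [hodd, add_zero]
  refine Finset.sum_subset_zero_on_sdiff ?_ ?_ ?_
  · rintro ⟨m, n⟩ h
    simp only [mem_filter, mem_product, mem_range] at h ⊢
    refine ⟨by omega, h.2, by omega⟩
  · rintro ⟨m, n⟩ h
    simp only [mem_sdiff, mem_filter, mem_product, mem_range] at h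
    have : r < m ∨ r < n := by
      by_contra hc
      exact h.2 ⟨by omega, h.1.2.1⟩
    rcases this with h | h <;> simp [aux_σ r _ h]
  · rintro ⟨m, n⟩ h
    simp only [mem_filter, mem_product, mem_range] at h
    have hs : (-1 : FlavorField r) ^ (m * n) = (-1) ^ m := by
      have he := Nat.even_add.mp h.2
      rcases Nat.even_or_odd m with hm | hm
      · rw [hm.neg_one_pow, (hm.mul_right n).neg_one_pow]
      · have hn : Odd n := by
          rw [← Nat.not_even_iff_odd] at hm ⊢; tauto
        rw [hm.neg_one_pow, (hm.mul hn).neg_one_pow]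
    obtain ⟨k, hk⟩ := h.2
    have hd : (d ^ 2) ^ (r - (m + n) / 2) = d ^ (r - m) * d ^ (r - n) := by
      rw [← pow_mul, ← pow_add]; congr 1; omega
    simp only [hs, hd]; ring

theorem aux_alg {K : Type*} [Field K] (u v a b P Q e : K) (hu : u ≠ 0) (hv : v ≠ 0)
    (hab : a - b ≠ 0) (he : e = 1 ∨ e = -1) :
    (u * (a - b)⁻¹ * P + v * (b - a)⁻¹ * (e * Q)) ^ 2 * (e * a * b * u⁻¹ * v⁻¹)
    + (e * u * v) * (u⁻¹ * a * (a - b)⁻¹ * Q + v⁻¹ * b * (b - a)⁻¹ * (e * P)) ^ 2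
    + (a + b) * (u * (a - b)⁻¹ * P + v * (b - a)⁻¹ * (e * Q))
      * (u⁻¹ * a * (a - b)⁻¹ * Q + v⁻¹ * b * (b - a)⁻¹ * (e * P)) = P * Q := by
  have hba : (b - a)⁻¹ = - (a - b)⁻¹ := by rw [← neg_sub, inv_neg]
  rw [hba]
  rcases he with rfl | rfl <;> field_simp <;> ring

theorem aux_ne (r : ℕ) {p : MvPolynomial (Fin 4 ⊕ Fin r) ℂ} (h : p ≠ 0) :
    algebraMap (MvPolynomial (Fin 4 ⊕ Fin r) ℂ) (FlavorField r) p ≠ 0 := by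
  intro h0
  exact h ((IsFractionRing.injective (MvPolynomial (Fin 4 ⊕ Fin r) ℂ) (FlavorField r))
    (by rw [h0, map_zero]))

/-- The defining relation of the flavor deformation of the Coulomb branch `M_C(r,2,1)`:
`sx₁²·sy₂ + sx₂·sy₁² + sw·sx₁·sy₁
  = Σ_{m+n even, m+n ≤ 2r} (−1)^{mn} σ_m σ_n (sw²−4 sx₂ sy₂)^{r−(m+n)/2}`. -/
theorem flavor_deformation_relation (r : ℕ) (hr : 1 ≤ r) :
    fsx₁ r ^ 2 * fsy₂ r + fsx₂ r * fsy₁ r ^ 2 + fsw r * fsx₁ r * fsy₁ r =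
      ∑ p ∈ (range (2 * r + 1) ×ˢ range (2 * r + 1)).filter
          (fun p => Even (p.1 + p.2) ∧ p.1 + p.2 ≤ 2 * r),
        (-1 : FlavorField r) ^ (p.1 * p.2) * fσ r p.1 * fσ r p.2 *
          (fsw r ^ 2 - 4 * fsx₂ r * fsy₂ r) ^ (r - (p.1 + p.2) / 2) := by
  have hu : fu₁ r ≠ 0 := aux_ne r (X_ne_zero _)
  have hv : fu₂ r ≠ 0 := aux_ne r (X_ne_zero _)
  have hab : fw₁ r - fw₂ r ≠ 0 := by
    rw [fw₁, fw₂, ← map_sub]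
    refine aux_ne r (sub_ne_zero.mpr fun h => ?_)
    have := X_injective h
    simp at this
  have he : ((-1 : FlavorField r) ^ r = 1 ∨ (-1 : FlavorField r) ^ r = -1) :=
    neg_one_pow_eq_or _ r
  have hQ : ∏ i : Fin r, (fw₂ r - fw₁ r - fz r i)
      = (-1) ^ r * ∏ i : Fin r, (fw₁ r - fw₂ r + fz r i) := by
    have : ∀ i, fw₂ r - fw₁ r - fz r i = (-1) * (fw₁ r - fw₂ r + fz r i) := fun i => by ring
    simp_rw [this]
    rw [Finset.prod_mul_distrib]; simp
  have hP : ∏ i : Fin r, (fw₂ r - fw₁ r + fz r i)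
      = (-1) ^ r * ∏ i : Fin r, (fw₁ r - fw₂ r - fz r i) := by
    have : ∀ i, fw₂ r - fw₁ r + fz r i = (-1) * (fw₁ r - fw₂ r - fz r i) := fun i => by ring
    simp_rw [this]
    rw [Finset.prod_mul_distrib]; simp
  have hD : fsw r ^ 2 - 4 * fsx₂ r * fsy₂ r = (fw₁ r - fw₂ r) ^ 2 := by
    rw [fsw, fsx₂, fsy₂]
    rcases he with he | he <;> rw [he] <;> field_simp <;> ring
  rw [hD, ← aux_PQ, fsx₁, fsy₁, fsx₂, fsy₂, fsw, hQ, hP]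
  exact aux_alg _ _ _ _ _ _ _ hu hv hab he
end

section
/- Let r ≥ 1 be an integer and let t be a complex number with |t| < 1. Then the family (n₁,n₂) ↦ t^{(2r−2)(n₁−n₂)+|n₁|+|n₂|} indexed by pairs of integers n₁ > n₂ is absolutely summable and Σ_{n₁>n₂∈ℤ} t^{(2r−2)(n₁−n₂)+|n₁|+|n₂|} = 2t^{2r−1}/((1−t²)(1−t^{2r−1})) + t^{4r−2}/(1−t^{2r−1})². -/
theorem mono_geom2 (x y : ℂ) (hx : ‖x‖ < 1) (hy : ‖y‖ < 1) (c : ℂ) :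
    HasSum (fun p : ℕ × ℕ => c * (x ^ p.1 * y ^ p.2)) (c * ((1 - x)⁻¹ * (1 - y)⁻¹)) := by
  apply HasSum.mul_left
  apply (hasSum_geometric_of_norm_lt_one hx).mul (hasSum_geometric_of_norm_lt_one hy)
  exact summable_mul_of_summable_norm (summable_norm_geometric_of_norm_lt_one hx)
    (summable_norm_geometric_of_norm_lt_one hy)

def monoMap : (ℕ × ℕ) ⊕ ((ℕ × ℕ) ⊕ (ℕ × ℕ)) → {p : ℤ × ℤ // p.2 < p.1}
  | Sum.inl p => ⟨((p.1 : ℤ) + p.2 + 1, (p.2 : ℤ)), by simp only; omega⟩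
  | Sum.inr (Sum.inl p) => ⟨(-(p.2 : ℤ), -((p.1 : ℤ) + p.2 + 1)), by simp only; omega⟩
  | Sum.inr (Sum.inr p) => ⟨((p.1 : ℤ) + 1, -((p.2 : ℤ) + 1)), by simp only; omega⟩

theorem monoMap_bij : Function.Bijective monoMap := by
  constructor
  · rintro (⟨a, b⟩ | ⟨a, b⟩ | ⟨a, b⟩) (⟨c, d⟩ | ⟨c, d⟩ | ⟨c, d⟩) h <;>
      simp only [monoMap, Subtype.mk.injEq, Prod.mk.injEq] at h <;>
      first
      | (exfalso; omega)
      | (obtain ⟨h1, h2⟩ := h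
         have h3 : a = c := by omega
         have h4 : b = d := by omega
         rw [h3, h4])
  · rintro ⟨⟨m, n⟩, h⟩
    simp only at h
    by_cases hn : 0 ≤ n
    · refine ⟨Sum.inl ((m - n - 1).toNat, n.toNat), ?_⟩
      simp only [monoMap, Subtype.mk.injEq, Prod.mk.injEq]
      omega
    · by_cases hm : m ≤ 0
      · refine ⟨Sum.inr (Sum.inl ((m - n - 1).toNat, (-m).toNat)), ?_⟩
        simp only [monoMap, Subtype.mk.injEq, Prod.mk.injEq]
        omega
      · refine ⟨Sum.inr (Sum.inr ((m - 1).toNat, (-n - 1).toNat)), ?_⟩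
        simp only [monoMap, Subtype.mk.injEq, Prod.mk.injEq]
        omega

theorem mono_hasSum (s : ℕ) (t : ℂ) (ht : ‖t‖ < 1) :
    HasSum (fun p : {p : ℤ × ℤ // p.2 < p.1} =>
      t ^ ((2 * ((s + 1 : ℕ) : ℤ) - 2) * (p.1.1 - p.1.2) + |p.1.1| + |p.1.2|))
      (t ^ (2 * s + 1) * ((1 - t ^ (2 * s + 1))⁻¹ * (1 - t ^ 2)⁻¹) +
        (t ^ (2 * s + 1) * ((1 - t ^ (2 * s + 1))⁻¹ * (1 - t ^ 2)⁻¹) +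
        t ^ (4 * s + 2) * ((1 - t ^ (2 * s + 1))⁻¹ * (1 - t ^ (2 * s + 1))⁻¹))) := by
  have hq : ‖t ^ (2 * s + 1)‖ < 1 := by
    rw [norm_pow]; exact pow_lt_one₀ (norm_nonneg _) ht (by omega)
  have h2 : ‖t ^ 2‖ < 1 := by
    rw [norm_pow]; exact pow_lt_one₀ (norm_nonneg _) ht (by omega)
  rw [← (Equiv.ofBijective _ monoMap_bij).hasSum_iff]
  refine HasSum.sum ?_ (HasSum.sum ?_ ?_)
  · convert mono_geom2 _ _ hq h2 (t ^ (2 * s + 1)) using 2 with p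
    obtain ⟨a, b⟩ := p
    simp only [Function.comp, Equiv.ofBijective_apply, monoMap, ← pow_mul, ← pow_add]
    rw [← zpow_natCast]
    congr 1
    rw [abs_of_nonneg (by positivity), abs_of_nonneg (by positivity)]
    push_cast; ring
  · convert mono_geom2 _ _ hq h2 (t ^ (2 * s + 1)) using 2 with p
    obtain ⟨a, b⟩ := p
    simp only [Function.comp, Equiv.ofBijective_apply, monoMap, ← pow_mul, ← pow_add]
    rw [← zpow_natCast]
    congr 1
    rw [abs_neg, abs_neg, abs_of_nonneg (by positivity), abs_of_nonneg (by positivity)]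
    push_cast; ring
  · convert mono_geom2 _ _ hq hq (t ^ (4 * s + 2)) using 2 with p
    obtain ⟨a, b⟩ := p
    simp only [Function.comp, Equiv.ofBijective_apply, monoMap, ← pow_mul, ← pow_add]
    rw [← zpow_natCast]
    congr 1
    rw [abs_neg, abs_of_nonneg (by positivity), abs_of_nonneg (by positivity)]
    push_cast; ring

/-- The regular part of the monopole formula sum for the Coulomb branch `M_C(r,2,1)`:
for `|t| < 1`, the family `t^{(2r−2)(n₁−n₂)+|n₁|+|n₂|}` over pairs of integers `n₁ > n₂`
is absolutely summable and its sum equals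
`2t^{2r−1}/((1−t²)(1−t^{2r−1})) + t^{4r−2}/(1−t^{2r−1})²`. -/
theorem monopole_sum_regular_rank_two (r : ℕ) (hr : 1 ≤ r) (t : ℂ) (ht : ‖t‖ < 1) :
    Summable (fun p : {p : ℤ × ℤ // p.2 < p.1} =>
      ‖t ^ ((2 * (r : ℤ) - 2) * (p.1.1 - p.1.2) + |p.1.1| + |p.1.2|)‖) ∧
    ∑' p : {p : ℤ × ℤ // p.2 < p.1},
        t ^ ((2 * (r : ℤ) - 2) * (p.1.1 - p.1.2) + |p.1.1| + |p.1.2|) =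
      2 * t ^ (2 * r - 1) / ((1 - t ^ 2) * (1 - t ^ (2 * r - 1)))
        + t ^ (4 * r - 2) / (1 - t ^ (2 * r - 1)) ^ 2 := by
  obtain ⟨s, rfl⟩ : ∃ s, r = s + 1 := ⟨r - 1, by omega⟩
  have h := mono_hasSum s t ht
  refine ⟨h.summable.norm, ?_⟩
  rw [h.tsum_eq]
  have e1 : 2 * (s + 1) - 1 = 2 * s + 1 := by omega
  have e2 : 4 * (s + 1) - 2 = 4 * s + 2 := by omega
  rw [e1, e2]
  simp only [div_eq_mul_inv, mul_inv, ← inv_pow]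
  ring
end
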